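/- Single-dealer capacity for the all-or-nothing access structure (Theorem 6): assume D = 1. The secret capacity is C(𝔸*) = min_{T⊊ℒ} I(Y_1; X_ℒ | X_T), where the minimum is over all strict subsets T of ℒ (including T = ∅). -/

import Mathlib

open scoped BigOperators
open Finset Filter

noncomputable section

namespace SecretSharing

open scoped Classical

/-! ### Basic Shannon information quantities (base 2) on finite probability spaces -/

variable {Ω : Type*} [Fintype Ω]

/-- `p` is a probability mass function on the finite type `Ω`. -/
def IsPMF (p : Ω → ℝ) : Prop := (∀ ω, 0 ≤ p ω) ∧ ∑ ω : Ω, p ω = 1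

/-- Probability that the random variable `X` takes the value `a` under `p`. -/
def prob (p : Ω → ℝ) {A : Type*} (X : Ω → A) (a : A) : ℝ :=
  ∑ ω : Ω, if X ω = a then p ω else 0

/-- Shannon entropy (in bits) of the random variable `X` under `p`. -/
def ent (p : Ω → ℝ) {A : Type*} [Fintype A] (X : Ω → A) : ℝ :=
  -∑ a : A, prob p X a * Real.logb 2 (prob p X a)

/-- Conditional Shannon entropy `H(X | Y)` in bits. -/
def condEnt (p : Ω → ℝ) {A B : Type*} [Fintype A] [Fintype B]
    (X : Ω → A) (Y : Ω → B) : ℝ :=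
  ent p (fun ω => (X ω, Y ω)) - ent p Y

/-- Mutual information `I(X ; Y)` in bits. -/
def mutInf (p : Ω → ℝ) {A B : Type*} [Fintype A] [Fintype B]
    (X : Ω → A) (Y : Ω → B) : ℝ :=
  ent p X + ent p Y - ent p (fun ω => (X ω, Y ω))

/-- Conditional mutual information `I(X ; Y | Z)` in bits. -/
def condMutInf (p : Ω → ℝ) {A B C : Type*} [Fintype A] [Fintype B] [Fintype C]
    (X : Ω → A) (Y : Ω → B) (Z : Ω → C) : ℝ :=
  condEnt p X Z - condEnt p X (fun ω => (Y ω, Z ω))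

/-! ### The distributed secret-sharing model -/

variable {L D : ℕ} {𝒳 : Fin L → Type} {𝒴 : Fin D → Type}
variable [∀ l, Fintype (𝒳 l)] [∀ d, Fintype (𝒴 d)]

/-- Sample space for one source symbol: the participants' observations and the
sub-dealers' observations. -/
abbrev Base (𝒳 : Fin L → Type) (𝒴 : Fin D → Type) : Type := (∀ l, 𝒳 l) × (∀ d, 𝒴 d)

/-- The i.i.d. product pmf of `p` over `n` source symbols. -/
def iid (p : Base 𝒳 𝒴 → ℝ) (n : ℕ) : (Fin n → Base 𝒳 𝒴) → ℝ :=
  fun ω => ∏ i, p (ω i)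

/-- Observations `X_T` of the set `T` of participants (single symbol). -/
def XT (T : Finset (Fin L)) : Base 𝒳 𝒴 → ∀ l : {l // l ∈ T}, 𝒳 l.1 :=
  fun ω l => ω.1 l.1

/-- Observations `Y_S` of the set `S` of sub-dealers (single symbol). -/
def YS (S : Finset (Fin D)) : Base 𝒳 𝒴 → ∀ d : {d // d ∈ S}, 𝒴 d.1 :=
  fun ω d => ω.2 d.1

/-- Observations `X_T^n` of the set `T` of participants over a block of length `n`. -/
def XTn (T : Finset (Fin L)) (n : ℕ) :
    (Fin n → Base 𝒳 𝒴) → ∀ l : {l // l ∈ T}, Fin n → 𝒳 l.1 :=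
  fun ω l i => (ω i).1 l.1

/-- Cardinality `⌈2^{n R_d}⌉` of the secret alphabet of sub-dealer `d`. -/
def secCard (R : Fin D → ℝ) (n : ℕ) (d : Fin D) : ℕ := ⌈(2:ℝ) ^ ((n : ℝ) * R d)⌉₊

/-- A secret-sharing strategy at blocklength `n` with rates `R`, for the access
structure `𝔸`: public messages, secrets, and decoders for authorized sets. -/
structure Strategy (𝒳 : Fin L → Type) (𝒴 : Fin D → Type)
    (𝔸 : Set (Finset (Fin L))) (R : Fin D → ℝ) (n : ℕ) where
  msgCard : Fin D → ℕ
  encM : ∀ d : Fin D, (Fin n → 𝒴 d) → Fin (msgCard d)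
  encS : ∀ d : Fin D, (Fin n → 𝒴 d) → Fin (secCard R n d)
  dec : ∀ A : Finset (Fin L), A ∈ 𝔸 →
    (∀ l : {l // l ∈ A}, Fin n → 𝒳 l.1) → (∀ d, Fin (msgCard d)) →
      ∀ d, Fin (secCard R n d)

variable {𝔸 : Set (Finset (Fin L))} {R : Fin D → ℝ} {n : ℕ}

/-- The public communication `M_𝒟` as a random variable. -/
def Strategy.Mrv (σ : Strategy 𝒳 𝒴 𝔸 R n) :
    (Fin n → Base 𝒳 𝒴) → ∀ d, Fin (σ.msgCard d) :=
  fun ω d => σ.encM d (fun i => (ω i).2 d)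

/-- The secrets `S_𝒟` as a random variable. -/
def Strategy.Srv (σ : Strategy 𝒳 𝒴 𝔸 R n) :
    (Fin n → Base 𝒳 𝒴) → ∀ d, Fin (secCard R n d) :=
  fun ω d => σ.encS d (fun i => (ω i).2 d)

/-- The estimate `Ŝ_𝒟(A)` computed by the authorized set `A`. -/
def Strategy.ShatRv (σ : Strategy 𝒳 𝒴 𝔸 R n) (A : Finset (Fin L)) (hA : A ∈ 𝔸) :
    (Fin n → Base 𝒳 𝒴) → ∀ d, Fin (secCard R n d) :=
  fun ω => σ.dec A hA (fun l i => (ω i).1 l.1) (σ.Mrv ω)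

/-- Error probability `P[Ŝ_𝒟(A) ≠ S_𝒟]`. -/
def Strategy.err (p : Base 𝒳 𝒴 → ℝ) (σ : Strategy 𝒳 𝒴 𝔸 R n)
    (A : Finset (Fin L)) (hA : A ∈ 𝔸) : ℝ :=
  ∑ ω : Fin n → Base 𝒳 𝒴, if σ.ShatRv A hA ω ≠ σ.Srv ω then iid p n ω else 0

/-- Information leakage `I(S_𝒟 ; M_𝒟, X_U^n)` to the set `U` of participants. -/
def Strategy.leak (p : Base 𝒳 𝒴 → ℝ) (σ : Strategy 𝒳 𝒴 𝔸 R n)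
    (U : Finset (Fin L)) : ℝ :=
  mutInf (iid p n) σ.Srv (fun ω => (σ.Mrv ω, XTn U n ω))

/-- Uniformity defect `log₂|𝒮_𝒟| - H(S_𝒟)`. -/
def Strategy.unif (p : Base 𝒳 𝒴 → ℝ) (σ : Strategy 𝒳 𝒴 𝔸 R n) : ℝ :=
  Real.logb 2 (∏ d, (secCard R n d : ℝ)) - ent (iid p n) σ.Srv

/-- Achievability of the rate tuple `R` for access structure `𝔸` and
unauthorized sets `𝕌`: a sequence of strategies with vanishing error
probability (for every authorized set), vanishing leakage (for every
unauthorized set), and vanishing uniformity defect. -/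
def Achievable (p : Base 𝒳 𝒴 → ℝ) (𝔸 𝕌 : Set (Finset (Fin L)))
    (R : Fin D → ℝ) : Prop :=
  (∀ d, 0 ≤ R d) ∧
  ∃ σ : (n : ℕ) → Strategy 𝒳 𝒴 𝔸 R n,
    (∀ A : Finset (Fin L), ∀ hA : A ∈ 𝔸,
      Tendsto (fun n => (σ n).err p A hA) atTop (nhds 0)) ∧
    (∀ U ∈ 𝕌, Tendsto (fun n => (σ n).leak p U) atTop (nhds 0)) ∧
    Tendsto (fun n => (σ n).unif p) atTop (nhds 0)

/-- `𝔸` is a monotone access structure: nonempty, not containing `∅`, and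
closed under taking supersets. -/
def MonotoneAccess (𝔸 : Set (Finset (Fin L))) : Prop :=
  𝔸.Nonempty ∧ ∅ ∉ 𝔸 ∧ ∀ A ∈ 𝔸, ∀ T : Finset (Fin L), A ⊆ T → T ∈ 𝔸

/-! ### Helper lemmas -/

section Helpers

lemma prob_nonneg {p : Ω → ℝ} (hp : IsPMF p) {A : Type*} (X : Ω → A) (a : A) :
    0 ≤ prob p X a :=
  Finset.sum_nonneg fun ω _ => by split_ifs <;> simp [hp.1 ω]

lemma prob_self_ge {p : Ω → ℝ} (hp : IsPMF p) {A : Type*} (X : Ω → A) (ω : Ω) :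
    p ω ≤ prob p X (X ω) := by
  have := Finset.single_le_sum (f := fun ω' => if X ω' = X ω then p ω' else 0)
    (fun ω' _ => by split_ifs <;> simp [hp.1 ω']) (Finset.mem_univ ω)
  simpa [prob] using this

/-- Expectation of a function of `X`. -/
lemma sum_prob_mul (p : Ω → ℝ) {A : Type*} [Fintype A] (X : Ω → A) (g : A → ℝ) :
    ∑ a, prob p X a * g a = ∑ ω, p ω * g (X ω) := by
  simp only [prob, Finset.sum_mul]
  rw [Finset.sum_comm]
  refine Finset.sum_congr rfl fun ω _ => ?_
  simp [ite_mul]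

lemma ent_eq (p : Ω → ℝ) {A : Type*} [Fintype A] (X : Ω → A) :
    ent p X = -∑ ω, p ω * Real.logb 2 (prob p X (X ω)) := by
  rw [ent, sum_prob_mul p X (fun a => Real.logb 2 (prob p X a))]

lemma prob_congr (p : Ω → ℝ) {A B : Type*} (X : Ω → A) (Y : Ω → B)
    (h : ∀ ω ω', X ω = X ω' ↔ Y ω = Y ω') (ω : Ω) :
    prob p X (X ω) = prob p Y (Y ω) := by
  simp only [prob, h]

lemma ent_congr (p : Ω → ℝ) {A B : Type*} [Fintype A] [Fintype B] (X : Ω → A) (Y : Ω → B)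
    (h : ∀ ω ω', X ω = X ω' ↔ Y ω = Y ω') : ent p X = ent p Y := by
  simp only [ent_eq, prob_congr p X Y h]

lemma condEnt_congr (p : Ω → ℝ) {A B A' B' : Type*} [Fintype A] [Fintype B]
    [Fintype A'] [Fintype B'] (X : Ω → A) (Y : Ω → B) (X' : Ω → A') (Y' : Ω → B')
    (h : ∀ ω ω', X ω = X ω' ↔ X' ω = X' ω') (h' : ∀ ω ω', Y ω = Y ω' ↔ Y' ω = Y' ω') :
    condEnt p X Y = condEnt p X' Y' := by
  unfold condEnt
  rw [ent_congr p Y Y' h', ent_congr p (fun ω => (X ω, Y ω)) (fun ω => (X' ω, Y' ω))]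
  intro ω ω'
  simp [h, h']

/-- Conditional probability of the realized value of `X` given that of `Y`. -/
def cpr (p : Ω → ℝ) {A B : Type*} (X : Ω → A) (Y : Ω → B) (ω : Ω) : ℝ :=
  prob p (fun ω => (X ω, Y ω)) (X ω, Y ω) / prob p Y (Y ω)

lemma cpr_nonneg {p : Ω → ℝ} (hp : IsPMF p) {A B : Type*} (X : Ω → A) (Y : Ω → B) (ω : Ω) :
    0 ≤ cpr p X Y ω := div_nonneg (prob_nonneg hp _ _) (prob_nonneg hp _ _)

lemma prob_pos {p : Ω → ℝ} (hp : IsPMF p) {A : Type*} (X : Ω → A) {ω : Ω} (h : 0 < p ω) :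
    0 < prob p X (X ω) := h.trans_le (prob_self_ge hp X ω)

lemma cpr_pos {p : Ω → ℝ} (hp : IsPMF p) {A B : Type*} (X : Ω → A) (Y : Ω → B) {ω : Ω}
    (h : 0 < p ω) : 0 < cpr p X Y ω :=
  div_pos (prob_pos hp (fun ω => (X ω, Y ω)) h) (prob_pos hp Y h)

lemma condEnt_eq {p : Ω → ℝ} (hp : IsPMF p) {A B : Type*} [Fintype A] [Fintype B]
    (X : Ω → A) (Y : Ω → B) :
    condEnt p X Y = -∑ ω, p ω * Real.logb 2 (cpr p X Y ω) := by
  unfold condEnt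
  rw [ent_eq, ent_eq, ← sub_eq_zero]
  rw [show ∀ a b c : ℝ, -a - -b - -c = b - a + c by intros; ring]
  rw [← Finset.sum_sub_distrib, ← Finset.sum_add_distrib]
  refine Finset.sum_eq_zero fun ω _ => ?_
  rcases (hp.1 ω).eq_or_lt with h | h
  · simp [← h]
  · rw [cpr, Real.logb_div (prob_pos hp (fun ω => (X ω, Y ω)) h).ne' (prob_pos hp Y h).ne']
    ring

lemma marg (p : Ω → ℝ) {A B : Type*} [Fintype A] (X : Ω → A) (Y : Ω → B) (b : B) :
    ∑ a, prob p (fun ω => (X ω, Y ω)) (a, b) = prob p Y b := by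
  simp only [prob]
  rw [Finset.sum_comm]
  refine Finset.sum_congr rfl fun ω _ => ?_
  by_cases h : Y ω = b <;> simp [h]

lemma prob_sum {p : Ω → ℝ} (hp : IsPMF p) {A : Type*} [Fintype A] (X : Ω → A) :
    ∑ a, prob p X a = 1 := by
  have := sum_prob_mul p X (fun _ => 1)
  simpa [hp.2] using this

/-- Gibbs inequality. -/
lemma condEnt_le {p : Ω → ℝ} (hp : IsPMF p) {A B : Type*} [Fintype A] [Fintype B]
    (X : Ω → A) (Y : Ω → B) (Q : A → B → ℝ) (hQ : ∀ a b, 0 ≤ Q a b)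
    (hsum : ∀ b, ∑ a, Q a b ≤ 1) (hpos : ∀ ω, 0 < p ω → 0 < Q (X ω) (Y ω)) :
    condEnt p X Y ≤ ∑ ω, p ω * (-Real.logb 2 (Q (X ω) (Y ω))) := by
  rw [condEnt_eq hp, ← sub_nonpos, neg_sub_left, neg_nonpos, ← Finset.sum_add_distrib]
  have hl2 : 0 < Real.log 2 := Real.log_pos (by norm_num)
  have key : ∀ ω, p ω * (1 - Q (X ω) (Y ω) / cpr p X Y ω) / Real.log 2 ≤
      p ω * -Real.logb 2 (Q (X ω) (Y ω)) + p ω * Real.logb 2 (cpr p X Y ω) := by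
    intro ω
    rcases (hp.1 ω).eq_or_lt with h | h
    · simp [← h]
    · have hc := cpr_pos hp X Y h
      have hq := hpos ω h
      have h1 := Real.log_le_sub_one_of_pos (div_pos hq hc)
      rw [Real.log_div hq.ne' hc.ne'] at h1
      rw [mul_div_assoc, ← mul_add]
      refine mul_le_mul_of_nonneg_left ?_ h.le
      rw [Real.logb, Real.logb, div_le_iff₀ hl2]
      field_simp
      field_simp at h1
      linarith
  refine le_trans ?_ (Finset.sum_le_sum fun ω _ => key ω)
  rw [← Finset.sum_div]
  refine div_nonneg ?_ hl2.le
  simp only [mul_sub, mul_one, Finset.sum_sub_distrib, hp.2, sub_nonneg]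
  have e := sum_prob_mul p (fun ω => (X ω, Y ω)) (fun ab => Q ab.1 ab.2 /
    (prob p (fun ω => (X ω, Y ω)) (ab.1, ab.2) / prob p Y ab.2))
  change _ = ∑ ω, p ω * (Q (X ω) (Y ω) / cpr p X Y ω) at e
  rw [← e, Fintype.sum_prod_type_right, ← prob_sum hp Y]
  refine Finset.sum_le_sum fun b _ => ?_
  calc _ ≤ ∑ a, Q a b * prob p Y b := by
        refine Finset.sum_le_sum fun a _ => ?_
        dsimp only
        rcases (prob_nonneg hp (fun ω => (X ω, Y ω)) (a, b)).eq_or_lt with h | h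
        · rw [← h]; simp [mul_nonneg (hQ a b) (prob_nonneg hp Y b)]
        · apply le_of_eq; field_simp
    _ = (∑ a, Q a b) * prob p Y b := by rw [Finset.sum_mul]
    _ ≤ 1 * prob p Y b := mul_le_mul_of_nonneg_right (hsum b) (prob_nonneg hp Y b)
    _ = _ := one_mul _

lemma condEnt_mono {p : Ω → ℝ} (hp : IsPMF p) {A B C : Type*} [Fintype A] [Fintype B] [Fintype C]
    (X : Ω → A) (Y : Ω → B) (Z : Ω → C) (g : C → B) (hg : ∀ ω, Y ω = g (Z ω)) :
    condEnt p X Z ≤ condEnt p X Y := by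
  refine (condEnt_le hp X Z
    (fun a c => prob p (fun ω => (X ω, Y ω)) (a, g c) / prob p Y (g c)) ?_ ?_ ?_).trans ?_
  · exact fun a c => div_nonneg (prob_nonneg hp _ _) (prob_nonneg hp _ _)
  · intro c
    rw [← Finset.sum_div, marg]
    exact div_self_le_one _
  · intro ω h
    rw [← hg]
    exact cpr_pos hp X Y h
  · rw [condEnt_eq hp]
    apply le_of_eq
    simp only [mul_neg, Finset.sum_neg_distrib, ← hg]
    rfl

lemma condEnt_nonneg {p : Ω → ℝ} (hp : IsPMF p) {A B : Type*} [Fintype A] [Fintype B]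
    (X : Ω → A) (Y : Ω → B) : 0 ≤ condEnt p X Y := by
  rw [condEnt_eq hp, neg_nonneg]
  refine Finset.sum_nonpos fun ω _ => mul_nonpos_of_nonneg_of_nonpos (hp.1 ω) ?_
  refine Real.logb_nonpos (by norm_num) (cpr_nonneg hp X Y ω) ?_
  refine div_le_one_of_le₀ ?_ (prob_nonneg hp _ _)
  unfold prob
  refine Finset.sum_le_sum fun ω' _ => ?_
  by_cases h : Y ω' = Y ω <;> by_cases h' : X ω' = X ω <;> simp [h, h', hp.1 ω']

lemma condEnt_le_log {p : Ω → ℝ} (hp : IsPMF p) {A B : Type*} [Fintype A] [Fintype B]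
    [Nonempty A] (X : Ω → A) (Y : Ω → B) : condEnt p X Y ≤ Real.logb 2 (Fintype.card A) := by
  have hA : (0:ℝ) < Fintype.card A := by exact_mod_cast Fintype.card_pos
  refine (condEnt_le hp X Y (fun _ _ => (Fintype.card A : ℝ)⁻¹) ?_ ?_ ?_).trans ?_
  · intros; positivity
  · intro b; simp [hA.ne']
  · intros; positivity
  · rw [← Finset.sum_mul, hp.2]; simp [Real.logb_inv]

lemma ent_unit {p : Ω → ℝ} (hp : IsPMF p) : ent p (fun _ : Ω => ()) = 0 := by
  have : ∀ a, prob p (fun _ : Ω => ()) a = 1 := by intro a; simp [prob, hp.2]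
  simp [ent, this]

lemma ent_eq_condEnt {p : Ω → ℝ} (hp : IsPMF p) {A : Type*} [Fintype A] (X : Ω → A) :
    ent p X = condEnt p X (fun _ => ()) := by
  unfold condEnt
  rw [ent_unit hp, sub_zero]
  apply ent_congr; simp

lemma ent_le_log {p : Ω → ℝ} (hp : IsPMF p) {A : Type*} [Fintype A]
    [Nonempty A] (X : Ω → A) : ent p X ≤ Real.logb 2 (Fintype.card A) := by
  rw [ent_eq_condEnt hp]; exact condEnt_le_log hp _ _

lemma mutInf_eq (p : Ω → ℝ) {A B : Type*} [Fintype A] [Fintype B]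
    (X : Ω → A) (Y : Ω → B) : mutInf p X Y = ent p X - condEnt p X Y := by
  unfold mutInf condEnt; ring

lemma mutInf_nonneg {p : Ω → ℝ} (hp : IsPMF p) {A B : Type*} [Fintype A] [Fintype B]
    (X : Ω → A) (Y : Ω → B) : 0 ≤ mutInf p X Y := by
  rw [mutInf_eq, ent_eq_condEnt hp, sub_nonneg]
  exact condEnt_mono hp X (fun _ => ()) Y (fun _ => ()) (fun _ => rfl)

/-- Fano's inequality. -/
lemma fano {p : Ω → ℝ} (hp : IsPMF p) {A B : Type*} [Fintype A] [Fintype B]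
    [Nonempty A] (X : Ω → A) (Y : Ω → B) (ψ : B → A) :
    condEnt p X Y ≤ 1 + (∑ ω, if ψ (Y ω) ≠ X ω then p ω else 0) *
      Real.logb 2 (Fintype.card A) := by
  have hA : (0:ℝ) < Fintype.card A := by exact_mod_cast Fintype.card_pos
  refine (condEnt_le hp X Y
    (fun a b => if ψ b = a then 2⁻¹ else (2 * (Fintype.card A : ℝ))⁻¹) ?_ ?_ ?_).trans ?_
  · intros; split_ifs <;> positivity
  · intro b
    calc _ ≤ ∑ a, ((if ψ b = a then (2:ℝ)⁻¹ else 0) + (2 * (Fintype.card A : ℝ))⁻¹) := by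
          refine Finset.sum_le_sum fun a _ => ?_
          have : (0:ℝ) ≤ (2 * (Fintype.card A : ℝ))⁻¹ := by positivity
          split_ifs <;> linarith
      _ = 1 := by
          rw [Finset.sum_add_distrib]
          simp
          field_simp
          norm_num
  · intros; split_ifs <;> positivity
  · have : ∀ ω, p ω * -Real.logb 2 (if ψ (Y ω) = X ω then 2⁻¹ else (2 * (Fintype.card A : ℝ))⁻¹)
        = p ω + (if ψ (Y ω) ≠ X ω then p ω else 0) * Real.logb 2 (Fintype.card A) := by
      intro ω
      by_cases h : ψ (Y ω) = X ω
      · simp [h, Real.logb_inv, Real.logb_self_eq_one]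
      · simp only [h, if_false, Real.logb_inv, neg_neg, ne_eq, not_false_eq_true, if_true]
        rw [Real.logb_mul (by norm_num) hA.ne', Real.logb_self_eq_one (by norm_num)]
        ring
    simp only [this]
    rw [Finset.sum_add_distrib, hp.2, Finset.sum_mul]

/-- Abstract converse: single-shot bound. -/
lemma converse_step {p : Ω → ℝ} (hp : IsPMF p) {A B C D' E : Type*} [Fintype A] [Fintype B]
    [Fintype C] [Fintype D'] [Fintype E]
    (S : Ω → A) (M : Ω → B) (Y : Ω → C) (XU : Ω → D') (XL : Ω → E)
    (s : C → A) (hs : ∀ ω, S ω = s (Y ω)) (m : C → B) (hm : ∀ ω, M ω = m (Y ω))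
    (r : E → D') (hr : ∀ ω, XU ω = r (XL ω)) :
    condEnt p S (fun ω => (M ω, XU ω)) ≤ condEnt p S (fun ω => (M ω, XL ω)) +
      (condEnt p Y XU - condEnt p Y XL) := by
  have h1 : condEnt p XL (fun ω => (M ω, XU ω)) ≤ condEnt p XL XU :=
    condEnt_mono hp _ _ _ Prod.snd (fun _ => rfl)
  have h2 : condEnt p XL (fun ω => (Y ω, XU ω)) ≤ condEnt p XL (fun ω => (S ω, M ω, XU ω)) :=
    condEnt_mono hp _ _ _ (fun c => (s c.1, m c.1, c.2)) (fun ω => by simp [hs, hm])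
  have e1 : ent p (fun ω => (XL ω, M ω, XU ω)) = ent p (fun ω => (M ω, XL ω)) := by
    apply ent_congr; intro ω ω'; simp [hr]; grind
  have e2 : ent p (fun ω => (XL ω, XU ω)) = ent p XL := by
    apply ent_congr; intro ω ω'; simp [hr]; grind
  have e3 : ent p (fun ω => (XL ω, Y ω, XU ω)) = ent p (fun ω => (Y ω, XL ω)) := by
    apply ent_congr; intro ω ω'; simp [hr]; grind
  have e4 : ent p (fun ω => (XL ω, S ω, M ω, XU ω)) = ent p (fun ω => (S ω, M ω, XL ω)) := by
    apply ent_congr; intro ω ω'; simp [hr]; grind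
  unfold condEnt at *
  linarith

end Helpers

section Iid

/-- Product pmf. -/
def piid (p : Ω → ℝ) (n : ℕ) : (Fin n → Ω) → ℝ := fun ω => ∏ i, p (ω i)

lemma sum_pi_prod (n : ℕ) (f : Fin n → Ω → ℝ) :
    ∑ ω : Fin n → Ω, ∏ i, f i (ω i) = ∏ i, ∑ a, f i a := by
  rw [Finset.prod_univ_sum, Fintype.piFinset_univ]

lemma piid_pmf {p : Ω → ℝ} (hp : IsPMF p) (n : ℕ) : IsPMF (piid p n) := by
  refine ⟨fun ω => Finset.prod_nonneg fun i _ => hp.1 _, ?_⟩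
  unfold piid
  rw [sum_pi_prod n (fun _ => p)]
  simp [hp.2]

lemma piid_prob (p : Ω → ℝ) (n : ℕ) {A : Type*} (X : Ω → A) (a : Fin n → A) :
    prob (piid p n) (fun ω i => X (ω i)) a = ∏ i, prob p X (a i) := by
  unfold prob
  rw [← sum_pi_prod n (fun i ω => if X ω = a i then p ω else 0)]
  refine Finset.sum_congr rfl fun ω _ => ?_
  by_cases h : (fun i => X (ω i)) = a
  · rw [if_pos h]
    refine Finset.prod_congr rfl fun i _ => ?_
    rw [if_pos (congrFun h i)]
  · rw [if_neg h]
    obtain ⟨i, hi⟩ := Function.ne_iff.1 h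
    symm
    exact Finset.prod_eq_zero (Finset.mem_univ i) (if_neg hi)

lemma piid_cpr (p : Ω → ℝ) (n : ℕ) {A B : Type*} (X : Ω → A) (Y : Ω → B) (ω : Fin n → Ω) :
    cpr (piid p n) (fun ω i => X (ω i)) (fun ω i => Y (ω i)) ω = ∏ i, cpr p X Y (ω i) := by
  unfold cpr
  rw [Finset.prod_div_distrib, piid_prob]
  congr 1
  have := prob_congr (piid p n) (fun ω => (fun i => X (ω i), fun i => Y (ω i)))
    (fun ω i => (X (ω i), Y (ω i))) (by intro ω ω'; simp [funext_iff, forall_and]) ω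
  rw [this, piid_prob p n (fun ω => (X ω, Y ω))]

lemma piid_sum {p : Ω → ℝ} (hp : IsPMF p) (n : ℕ) (g : Ω → ℝ) :
    ∑ ω, piid p n ω * ∑ i, g (ω i) = n * ∑ ω, p ω * g ω := by
  simp only [Finset.mul_sum]
  rw [Finset.sum_comm]
  have : ∀ i : Fin n, ∑ ω : Fin n → Ω, piid p n ω * g (ω i) = ∑ ω, p ω * g ω := by
    intro i
    have h := sum_pi_prod n (fun j a => p a * if j = i then g a else 1)
    have h2 : ∀ j : Fin n, (∑ a, p a * if j = i then g a else 1) =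
        if j = i then ∑ a, p a * g a else 1 := by
      intro j
      by_cases hj : j = i <;> simp [hj, hp.2]
    simp only [h2, Finset.prod_mul_distrib, Finset.prod_ite_eq', Finset.mem_univ, if_true] at h
    exact h
  simp only [this]
  simp [Finset.mul_sum]

lemma piid_condEnt {p : Ω → ℝ} (hp : IsPMF p) (n : ℕ) {A B : Type*} [Fintype A] [Fintype B]
    (X : Ω → A) (Y : Ω → B) :
    condEnt (piid p n) (fun ω i => X (ω i)) (fun ω i => Y (ω i)) = n * condEnt p X Y := by
  rw [condEnt_eq (piid_pmf hp n), condEnt_eq hp, mul_neg, ← piid_sum hp n]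
  congr 1
  refine Finset.sum_congr rfl fun ω _ => ?_
  rw [piid_cpr]
  rcases ((piid_pmf hp n).1 ω).eq_or_lt with h | h
  · simp [← h]
  · rw [Real.logb_prod]
    intro i _
    refine (cpr_pos hp X Y ((hp.1 _).lt_of_ne' fun h0 => h.ne' ?_)).ne'
    exact Finset.prod_eq_zero (Finset.mem_univ i) h0

lemma piid_moment {p : Ω → ℝ} (hp : IsPMF p) (n : ℕ) {A B : Type*}
    (X : Ω → A) (Y : Ω → B) (R t : ℝ) :
    ∑ ω, piid p n ω * ((2:ℝ) ^ (n * R) *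
      cpr (piid p n) (fun ω i => X (ω i)) (fun ω i => Y (ω i)) ω) ^ t =
    (∑ ω, p ω * ((2:ℝ) ^ R * cpr p X Y ω) ^ t) ^ n := by
  have := sum_pi_prod n (fun _ ω => p ω * ((2:ℝ) ^ R * cpr p X Y ω) ^ t)
  rw [Finset.prod_const, Finset.card_univ, Fintype.card_fin] at this
  rw [← this]
  refine Finset.sum_congr rfl fun ω _ => ?_
  rw [piid_cpr, Finset.prod_mul_distrib, piid, Real.finsetProd_rpow, Finset.prod_mul_distrib,
    Finset.prod_const, Finset.card_univ, Fintype.card_fin, ← Real.rpow_natCast,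
    ← Real.rpow_mul (by norm_num), mul_comm R]
  intro i _
  exact mul_nonneg (by positivity) (cpr_nonneg hp X Y _)

lemma exp_decay {p : Ω → ℝ} (hp : IsPMF p) (a : Ω → ℝ) (h : ∑ ω, p ω * a ω < 0) :
    ∃ s : ℝ, 0 < s ∧ s ≤ 1 ∧ ∑ ω, p ω * Real.exp (s * a ω) < 1 := by
  have hd : HasDerivAt (fun s : ℝ => ∑ ω, p ω * Real.exp (s * a ω)) (∑ ω, p ω * a ω) 0 := by
    have : ∀ ω ∈ (Finset.univ : Finset Ω),
        HasDerivAt (fun s : ℝ => p ω * Real.exp (s * a ω)) (p ω * a ω) 0 := by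
      intro ω _
      have h1 : HasDerivAt (fun s : ℝ => s * a ω) (a ω) 0 := hasDerivAt_mul_const (a ω)
      simpa using (h1.exp).const_mul (p ω)
    exact HasDerivAt.fun_sum this
  rw [hasDerivAt_iff_tendsto_slope] at hd
  have h1 := (hd.eventually_lt_const h).filter_mono (nhdsWithin_mono 0
    (fun x (hx : x ∈ Set.Ioi (0:ℝ)) => (ne_of_gt hx : x ≠ 0)))
  have h2 : ∀ᶠ s in nhdsWithin (0:ℝ) (Set.Ioi 0), s ∈ Set.Ioo (0:ℝ) 1 :=
    Ioo_mem_nhdsGT one_pos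
  obtain ⟨s, hs, hs0, hs1⟩ := (h1.and h2).exists
  refine ⟨s, hs0, hs1.le, ?_⟩
  rw [slope_def_field, sub_zero, div_lt_iff₀ hs0] at hs
  simp [hp.2] at hs
  linarith

lemma decay {p : Ω → ℝ} (hp : IsPMF p) {A B : Type*} [Fintype A] [Fintype B]
    (X : Ω → A) (Y : Ω → B) (R ε : ℝ) (h : ε * (R - condEnt p X Y) < 0) :
    ∃ s : ℝ, 0 < s ∧ s ≤ 1 ∧ ∑ ω, p ω * ((2:ℝ) ^ R * cpr p X Y ω) ^ (ε * s) < 1 := by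
  have hl2 : 0 < Real.log 2 := Real.log_pos (by norm_num)
  obtain ⟨s, h0, h1, hs⟩ := exp_decay hp
    (fun ω => ε * (R * Real.log 2 + Real.log (cpr p X Y ω))) (by
      have : ∑ ω, p ω * (ε * (R * Real.log 2 + Real.log (cpr p X Y ω))) =
          (ε * (R - condEnt p X Y)) * Real.log 2 := by
        have e : ∑ ω, p ω * Real.log (cpr p X Y ω) = - condEnt p X Y * Real.log 2 := by
          rw [condEnt_eq hp, neg_neg, Finset.sum_mul]
          refine Finset.sum_congr rfl fun ω _ => ?_
          rw [Real.logb]; field_simp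
        calc _ = ε * ((∑ ω, p ω) * (R * Real.log 2) + ∑ ω, p ω * Real.log (cpr p X Y ω)) := by
              rw [Finset.sum_mul, ← Finset.sum_add_distrib, Finset.mul_sum]
              refine Finset.sum_congr rfl fun ω _ => ?_
              ring
          _ = _ := by rw [hp.2, e]; ring
      rw [this]
      exact mul_neg_of_neg_of_pos h hl2)
  refine ⟨s, h0, h1, lt_of_eq_of_lt ?_ hs⟩
  refine Finset.sum_congr rfl fun ω _ => ?_
  rcases (hp.1 ω).eq_or_lt with h | h
  · simp [← h]
  · have hc := cpr_pos hp X Y h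
    have h2 : (0:ℝ) < 2 ^ R := by positivity
    rw [Real.rpow_def_of_pos (mul_pos h2 hc), Real.log_mul h2.ne' hc.ne',
      Real.log_rpow (by norm_num)]
    ring_nf

end Iid

section OneShot

lemma count_eq {A κ : Type*} [Fintype A] [Fintype κ] {y y' : A} (h : y ≠ y') :
    (∑ F : A → κ, if F y' = F y then (1:ℝ) else 0) * Fintype.card κ ≤
      Fintype.card (A → κ) := by
  rw [Finset.sum_boole]
  rw [← Fintype.card_subtype]
  rw [← Nat.cast_mul, Nat.cast_le, ← Fintype.card_prod]
  refine Fintype.card_le_of_injective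
    (fun q : {F : A → κ // F y' = F y} × κ => Function.update q.1.1 y' q.2) ?_
  rintro ⟨⟨F, hF⟩, k⟩ ⟨⟨G, hG⟩, k'⟩ e
  dsimp only at e
  have hk : k = k' := by simpa using congrFun e y'
  have hy : F y = G y := by simpa [h] using congrFun e y
  have : F = G := by
    funext x
    by_cases hx : x = y'
    · rw [hx, hF, hG, hy]
    · simpa [hx] using congrFun e x
  subst this; subst hk; rfl

lemma count_fst {A μ σ : Type*} [Fintype A] [Fintype μ] [Fintype σ] {y y' : A} (h : y ≠ y') :
    (∑ F : A → μ × σ, if (F y').1 = (F y).1 then (1:ℝ) else 0) * Fintype.card μ ≤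
      Fintype.card (A → μ × σ) := by
  rw [Finset.sum_boole]
  rw [← Fintype.card_subtype]
  rw [← Nat.cast_mul, Nat.cast_le, ← Fintype.card_prod]
  refine Fintype.card_le_of_injective
    (fun q : {F : A → μ × σ // (F y').1 = (F y).1} × μ =>
      Function.update q.1.1 y' (q.2, (q.1.1 y').2)) ?_
  rintro ⟨⟨F, hF⟩, k⟩ ⟨⟨G, hG⟩, k'⟩ e
  dsimp only at e
  have hk : k = k' ∧ (F y').2 = (G y').2 := by simpa using congrFun e y'
  have hy : F y = G y := by simpa [h] using congrFun e y
  have : F = G := by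
    funext x
    by_cases hx : x = y'
    · rw [hx]
      exact Prod.ext (by rw [hF, hG, hy]) hk.2
    · simpa [hx] using congrFun e x
  obtain ⟨hk, -⟩ := hk
  subst this; subst hk; rfl

/-- Privacy amplification with a random function. -/
lemma privacy {p : Ω → ℝ} (hp : IsPMF p) {A B κ : Type*} [Fintype A] [Fintype B]
    [Fintype κ] [Nonempty κ] (Y : Ω → A) (Z : Ω → B) :
    ∑ F : A → κ, (Real.logb 2 (Fintype.card κ) - condEnt p (fun ω => F (Y ω)) Z) ≤
      Fintype.card (A → κ) * ∑ ω, p ω * Real.logb 2 (1 + Fintype.card κ * cpr p Y Z ω) := by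
  have hl2 : 0 < Real.log 2 := Real.log_pos (by norm_num)
  have hκ : (0:ℝ) < Fintype.card κ := by exact_mod_cast Fintype.card_pos
  have hN : (0:ℝ) < Fintype.card (A → κ) := by exact_mod_cast Fintype.card_pos
  have e : ∀ F : A → κ, Real.logb 2 (Fintype.card κ) - condEnt p (fun ω => F (Y ω)) Z =
      ∑ ω, p ω * Real.logb 2 (Fintype.card κ * cpr p (fun ω => F (Y ω)) Z ω) := by
    intro F
    rw [condEnt_eq hp, sub_neg_eq_add, ← one_mul (Real.logb 2 (Fintype.card κ : ℝ)), ← hp.2,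
      Finset.sum_mul, ← Finset.sum_add_distrib]
    refine Finset.sum_congr rfl fun ω _ => ?_
    rcases (hp.1 ω).eq_or_lt with h | h
    · simp [← h]
    · rw [Real.logb_mul hκ.ne' (cpr_pos hp _ _ h).ne']; ring
  simp only [e]
  rw [Finset.sum_comm, Finset.mul_sum]
  refine Finset.sum_le_sum fun ω _ => ?_
  rcases (hp.1 ω).eq_or_lt with h | h
  · simp [← h]
  rw [← Finset.mul_sum, mul_left_comm]
  refine mul_le_mul_of_nonneg_left ?_ h.le
  -- Jensen by tangent line
  set b : ℝ := 1 + Fintype.card κ * cpr p Y Z ω with hb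
  have hbpos : 0 < b := by
    have := mul_pos hκ (cpr_pos hp Y Z h); positivity
  have hz := prob_pos hp Z h
  have hsum : ∑ F : A → κ, Fintype.card κ * cpr p (fun ω => F (Y ω)) Z ω ≤
      Fintype.card (A → κ) * b := by
    have h1 : ∀ F : A → κ, Fintype.card κ * cpr p (fun ω => F (Y ω)) Z ω =
        (∑ ω', (if Z ω' = Z ω then p ω' else 0) *
          ((if F (Y ω') = F (Y ω) then (1:ℝ) else 0) * Fintype.card κ)) / prob p Z (Z ω) := by
      intro F
      rw [cpr, mul_div_assoc']
      congr 1
      rw [prob, Finset.mul_sum]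
      refine Finset.sum_congr rfl fun ω' _ => ?_
      by_cases h1 : Z ω' = Z ω <;> by_cases h2 : F (Y ω') = F (Y ω) <;> simp [h1, h2, mul_comm]
    simp only [h1]
    rw [← Finset.sum_div, div_le_iff₀ hz, Finset.sum_comm]
    have h2 : ∀ ω', ∑ F : A → κ, (if Z ω' = Z ω then p ω' else 0) *
          ((if F (Y ω') = F (Y ω) then (1:ℝ) else 0) * Fintype.card κ) ≤
        Fintype.card (A → κ) * ((if Z ω' = Z ω then p ω' else 0) + Fintype.card κ *
          (if (Y ω', Z ω') = (Y ω, Z ω) then p ω' else 0)) := by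
      intro ω'
      rw [← Finset.mul_sum, ← Finset.sum_mul]
      by_cases h3 : Z ω' = Z ω
      · by_cases h4 : Y ω' = Y ω
        · simp only [h3, h4, if_true, Finset.sum_const, Finset.card_univ, nsmul_eq_mul, mul_one]
          have := mul_nonneg hN.le (hp.1 ω')
          linarith
        · have := mul_le_mul_of_nonneg_left (count_eq (κ := κ) (Ne.symm h4)) (hp.1 ω')
          simp only [h3, if_true, Prod.mk.injEq, h4, false_and, if_false, mul_zero, add_zero]
          linarith
      · simp [h3]
    refine (Finset.sum_le_sum fun ω' _ => h2 ω').trans (le_of_eq ?_)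
    rw [← Finset.mul_sum, Finset.sum_add_distrib, ← Finset.mul_sum, hb, cpr, mul_assoc]
    congr 1
    have : prob p (fun ω => (Y ω, Z ω)) (Y ω, Z ω) =
      ∑ ω', (if (Y ω', Z ω') = (Y ω, Z ω) then p ω' else 0) := by
      unfold prob; refine Finset.sum_congr rfl fun ω' _ => ?_; congr
    rw [← this]
    have : prob p Z (Z ω) = ∑ ω', (if Z ω' = Z ω then p ω' else 0) := rfl
    rw [← this]
    field_simp
  have hlog : ∀ F : A → κ, Real.logb 2 (Fintype.card κ * cpr p (fun ω => F (Y ω)) Z ω) ≤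
      Real.logb 2 b + (Fintype.card κ * cpr p (fun ω => F (Y ω)) Z ω / b - 1) / Real.log 2 := by
    intro F
    have hx := mul_pos hκ (cpr_pos hp (fun ω => F (Y ω)) Z h)
    have h1 := Real.log_le_sub_one_of_pos (div_pos hx hbpos)
    rw [Real.log_div hx.ne' hbpos.ne'] at h1
    rw [Real.logb, Real.logb, ← add_div]
    exact div_le_div_of_nonneg_right (by linarith) hl2.le
  refine (Finset.sum_le_sum fun F _ => hlog F).trans ?_
  rw [Finset.sum_add_distrib, ← Finset.sum_div, Finset.sum_sub_distrib, ← Finset.sum_div]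
  simp only [Finset.sum_const, Finset.card_univ, nsmul_eq_mul, mul_one]
  have : (∑ F : A → κ, Fintype.card κ * cpr p (fun ω => F (Y ω)) Z ω) / b ≤
      Fintype.card (A → κ) := by rwa [div_le_iff₀ hbpos]
  have : ((∑ F : A → κ, Fintype.card κ * cpr p (fun ω => F (Y ω)) Z ω) / b -
      Fintype.card (A → κ)) / Real.log 2 ≤ 0 :=
    div_nonpos_of_nonpos_of_nonneg (by linarith) hl2.le
  linarith

/-- Slepian-Wolf coding with random binning and MAP decoding. -/
lemma binning {p : Ω → ℝ} (hp : IsPMF p) {A B μ σ : Type*} [Fintype A] [Fintype B] [Nonempty A]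
    [Fintype μ] [Nonempty μ] [Fintype σ] [Nonempty σ] (Y : Ω → A) (Z : Ω → B) (s : ℝ)
    (hs0 : 0 < s) (hs1 : s ≤ 1) :
    ∃ ψ : (A → μ × σ) → B → μ → A,
    ∑ F : A → μ × σ, (∑ ω, if ψ F (Z ω) (F (Y ω)).1 ≠ Y ω then p ω else 0) ≤
      Fintype.card (A → μ × σ) * ∑ ω, p ω * (Fintype.card μ * cpr p Y Z ω) ^ (-s) := by
  have hμ : (0:ℝ) < Fintype.card μ := by exact_mod_cast Fintype.card_pos
  have hN : (0:ℝ) < Fintype.card (A → μ × σ) := by exact_mod_cast Fintype.card_pos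
  set P : A → B → ℝ := fun a b => prob p (fun ω => (Y ω, Z ω)) (a, b) with hP
  have hdec : ∀ (F : A → μ × σ) (b : B) (m : μ), ∃ a : A, ∀ y, (F y).1 = m →
      (F a).1 = m ∧ P y b ≤ P a b := by
    intro F b m
    by_cases hne : (Finset.univ.filter fun y => (F y).1 = m).Nonempty
    · obtain ⟨a, ha, hmax⟩ := Finset.exists_max_image _ (fun y => P y b) hne
      exact ⟨a, fun y hy => ⟨by simpa using ha, hmax y (by simpa using hy)⟩⟩
    · refine ⟨Classical.arbitrary A, fun y hy => absurd ⟨y, by simpa using hy⟩ hne⟩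
  choose ψ hψ using hdec
  refine ⟨ψ, ?_⟩
  rw [Finset.sum_comm, Finset.mul_sum]
  refine Finset.sum_le_sum fun ω _ => ?_
  rcases (hp.1 ω).eq_or_lt with h | h
  · simp [← h]
  have hc := cpr_pos hp Y Z h
  have hz := prob_pos hp Z h
  have hyz : 0 < P (Y ω) (Z ω) := prob_pos hp (fun ω => (Y ω, Z ω)) h
  rw [mul_left_comm]
  have e : ∀ F : A → μ × σ, (if ψ F (Z ω) (F (Y ω)).1 ≠ Y ω then p ω else 0) =
      p ω * (if ψ F (Z ω) (F (Y ω)).1 ≠ Y ω then 1 else 0) := by intro F; simp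
  simp only [e]
  rw [← Finset.mul_sum]
  refine mul_le_mul_of_nonneg_left ?_ h.le
  set x : ℝ := Fintype.card μ * cpr p Y Z ω with hx
  have hxpos : 0 < x := mul_pos hμ hc
  have b1 : ∑ F : A → μ × σ, (if ψ F (Z ω) (F (Y ω)).1 ≠ Y ω then (1:ℝ) else 0) ≤
      Fintype.card (A → μ × σ) := by
    calc _ ≤ ∑ F : A → μ × σ, (1:ℝ) := Finset.sum_le_sum fun F _ => by split_ifs <;> norm_num
      _ = _ := by simp
  have b2 : ∑ F : A → μ × σ, (if ψ F (Z ω) (F (Y ω)).1 ≠ Y ω then (1:ℝ) else 0) ≤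
      Fintype.card (A → μ × σ) * x⁻¹ := by
    have c1 : ∀ F : A → μ × σ, (if ψ F (Z ω) (F (Y ω)).1 ≠ Y ω then (1:ℝ) else 0) ≤
        ∑ y', (if y' ≠ Y ω then P y' (Z ω) / P (Y ω) (Z ω) else 0) *
          (if (F y').1 = (F (Y ω)).1 then (1:ℝ) else 0) := by
      intro F
      have hnn : ∀ y' ∈ (Finset.univ : Finset A),
          0 ≤ (if y' ≠ Y ω then P y' (Z ω) / P (Y ω) (Z ω) else 0) *
          (if (F y').1 = (F (Y ω)).1 then (1:ℝ) else 0) := by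
        intro y' _
        have := prob_nonneg hp (fun ω => (Y ω, Z ω)) (y', Z ω)
        have h2 : 0 ≤ P y' (Z ω) / P (Y ω) (Z ω) := div_nonneg this hyz.le
        apply mul_nonneg <;> split_ifs <;> first | exact h2 | norm_num
      by_cases hh : ψ F (Z ω) (F (Y ω)).1 ≠ Y ω
      · rw [if_pos hh]
        refine le_trans ?_ (Finset.single_le_sum hnn (Finset.mem_univ (ψ F (Z ω) (F (Y ω)).1)))
        obtain ⟨h1, h2⟩ := hψ F (Z ω) (F (Y ω)).1 (Y ω) rfl
        rw [if_pos hh, if_pos h1, mul_one, one_le_div hyz]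
        exact h2
      · rw [if_neg hh]
        exact Finset.sum_nonneg hnn
    refine (Finset.sum_le_sum fun F _ => c1 F).trans ?_
    rw [Finset.sum_comm]
    have c2 : ∀ y', ∑ F : A → μ × σ, (if y' ≠ Y ω then P y' (Z ω) / P (Y ω) (Z ω) else 0) *
          (if (F y').1 = (F (Y ω)).1 then (1:ℝ) else 0) ≤
        P y' (Z ω) * (Fintype.card (A → μ × σ) / (P (Y ω) (Z ω) * Fintype.card μ)) := by
      intro y'
      have hn := prob_nonneg hp (fun ω => (Y ω, Z ω)) (y', Z ω)
      rw [← Finset.mul_sum]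
      by_cases hy : y' ≠ Y ω
      · rw [if_pos hy]
        have := count_fst (μ := μ) (σ := σ) hy.symm
        rw [← le_div_iff₀ hμ] at this
        refine (mul_le_mul_of_nonneg_left this (div_nonneg hn hyz.le)).trans (le_of_eq ?_)
        field_simp
        rfl
      · rw [if_neg hy, zero_mul]
        exact mul_nonneg hn (by positivity)
    refine (Finset.sum_le_sum fun y' _ => c2 y').trans (le_of_eq ?_)
    rw [← Finset.sum_mul, hP, marg, hx, cpr]
    field_simp
  rcases le_total x 1 with hx1 | hx1
  · refine b1.trans (le_mul_of_one_le_right hN.le ?_)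
    exact Real.one_le_rpow_of_pos_of_le_one_of_nonpos hxpos hx1 (by linarith)
  · refine b2.trans (mul_le_mul_of_nonneg_left ?_ hN.le)
    rw [← Real.rpow_neg_one]
    exact Real.rpow_le_rpow_of_exponent_le hx1 (by linarith)

lemma logb_one_add_le {x s : ℝ} (hx : 0 ≤ x) (hs0 : 0 < s) (hs1 : s ≤ 1) :
    Real.logb 2 (1 + x) ≤ x ^ s / (s * Real.log 2) := by
  have hl2 : 0 < Real.log 2 := Real.log_pos (by norm_num)
  rw [Real.logb, div_le_div_iff₀ hl2 (by positivity)]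
  have h1 : (1 + x) ^ s ≤ 1 + x ^ s := by
    have := Real.rpow_add_le_add_rpow zero_le_one hx hs0.le hs1
    simpa using this
  have h2 : s * Real.log (1 + x) ≤ x ^ s := by
    rw [← Real.log_rpow (by positivity)]
    refine (Real.log_le_log (by positivity) h1).trans ?_
    have := Real.log_le_sub_one_of_pos (show 0 < 1 + x ^ s by positivity)
    linarith
  nlinarith

end OneShot

section Asymptotic

lemma exists_code {p : Ω → ℝ} (hp : IsPMF p) {A BL μ σ ι : Type*} {B : ι → Type*}
    [Fintype A] [Nonempty A] [Fintype BL] [∀ t, Fintype (B t)]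
    [Fintype μ] [Nonempty μ] [Fintype σ] [Nonempty σ]
    (Y : Ω → A) (ZL : Ω → BL) (Z : ∀ t, Ω → B t) (I : Finset ι) (s : ℝ)
    (hs0 : 0 < s) (hs1 : s ≤ 1) :
    ∃ (F : A → μ × σ) (ψ : BL → μ → A),
      ∑ t ∈ I, (Real.logb 2 (Fintype.card (μ × σ)) - condEnt p (fun ω => F (Y ω)) (Z t)) +
        (∑ ω, if ψ (ZL ω) (F (Y ω)).1 ≠ Y ω then p ω else 0) ≤
      ∑ t ∈ I, (∑ ω, p ω * Real.logb 2 (1 + Fintype.card (μ × σ) * cpr p Y (Z t) ω)) +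
        ∑ ω, p ω * (Fintype.card μ * cpr p Y ZL ω) ^ (-s) := by
  obtain ⟨ψ, hψ⟩ := binning hp (μ := μ) (σ := σ) Y ZL s hs0 hs1
  have hsum : ∑ F : A → μ × σ,
      (∑ t ∈ I, (Real.logb 2 (Fintype.card (μ × σ)) - condEnt p (fun ω => F (Y ω)) (Z t)) +
        (∑ ω, if ψ F (ZL ω) (F (Y ω)).1 ≠ Y ω then p ω else 0)) ≤
      ∑ _F : A → μ × σ,
      (∑ t ∈ I, (∑ ω, p ω * Real.logb 2 (1 + Fintype.card (μ × σ) * cpr p Y (Z t) ω)) +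
        ∑ ω, p ω * (Fintype.card μ * cpr p Y ZL ω) ^ (-s)) := by
    rw [Finset.sum_add_distrib, Finset.sum_const, Finset.card_univ, nsmul_eq_mul, mul_add]
    refine add_le_add ?_ hψ
    rw [Finset.sum_comm, Finset.mul_sum]
    exact Finset.sum_le_sum fun t _ => privacy hp Y (Z t)
  obtain ⟨F, -, hF⟩ := Finset.exists_le_of_sum_le Finset.univ_nonempty hsum
  exact ⟨F, ψ F, hF⟩

lemma moment_nonneg {p : Ω → ℝ} (hp : IsPMF p) {A B : Type*} (Y : Ω → A) (Z : Ω → B)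
    (c t : ℝ) (hc : 0 ≤ c) : 0 ≤ ∑ ω, p ω * (c * cpr p Y Z ω) ^ t :=
  Finset.sum_nonneg fun ω _ => mul_nonneg (hp.1 ω)
    (Real.rpow_nonneg (mul_nonneg hc (cpr_nonneg hp Y Z ω)) _)

lemma privacy_tendsto {p : Ω → ℝ} (hp : IsPMF p) {A B : Type*} [Fintype A] [Fintype B]
    (Y : Ω → A) (Z : Ω → B) (R : ℝ) (h : R < condEnt p Y Z) (K : ℕ → ℝ)
    (hK0 : ∀ n, 0 ≤ K n) (hK : ∀ n : ℕ, K n ≤ 4 * (2:ℝ) ^ (n * R)) :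
    Tendsto (fun n => ∑ ω, piid p n ω * Real.logb 2 (1 + K n *
      cpr (piid p n) (fun ω i => Y (ω i)) (fun ω i => Z (ω i)) ω)) atTop (nhds 0) := by
  have hl2 : 0 < Real.log 2 := Real.log_pos (by norm_num)
  obtain ⟨s, hs0, hs1, hs⟩ := decay hp Y Z R 1 (by linarith)
  rw [one_mul] at hs
  set r := ∑ ω, p ω * ((2:ℝ) ^ R * cpr p Y Z ω) ^ s with hr
  have hr0 : 0 ≤ r := moment_nonneg hp Y Z _ _ (by positivity)
  have ht : Tendsto (fun n : ℕ => (4 : ℝ) ^ s / (s * Real.log 2) * r ^ n) atTop (nhds 0) := by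
    simpa using (tendsto_pow_atTop_nhds_zero_of_lt_one hr0 hs).const_mul
      ((4 : ℝ) ^ s / (s * Real.log 2))
  refine squeeze_zero (fun n => ?_) (fun n => ?_) ht
  · refine Finset.sum_nonneg fun ω _ => mul_nonneg ((piid_pmf hp n).1 ω) ?_
    refine Real.logb_nonneg (by norm_num) ?_
    have := mul_nonneg (hK0 n) (cpr_nonneg (piid_pmf hp n)
      (fun ω i => Y (ω i)) (fun ω i => Z (ω i)) ω)
    linarith
  · rw [hr, ← piid_moment hp, Finset.mul_sum]
    refine Finset.sum_le_sum fun ω _ => ?_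
    have hc := cpr_nonneg (piid_pmf hp n) (fun ω i => Y (ω i)) (fun ω i => Z (ω i)) ω
    set c := cpr (piid p n) (fun ω i => Y (ω i)) (fun ω i => Z (ω i)) ω
    rw [mul_left_comm]
    refine mul_le_mul_of_nonneg_left ?_ ((piid_pmf hp n).1 ω)
    refine (logb_one_add_le (mul_nonneg (hK0 n) hc) hs0 hs1).trans ?_
    rw [div_mul_eq_mul_div, ← Real.mul_rpow (by norm_num) (by positivity)]
    refine div_le_div_of_nonneg_right ?_ (by positivity)
    refine Real.rpow_le_rpow (mul_nonneg (hK0 n) hc) ?_ hs0.le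
    rw [← mul_assoc]
    exact mul_le_mul_of_nonneg_right (hK n) hc

lemma binning_tendsto {p : Ω → ℝ} (hp : IsPMF p) {A B : Type*} [Fintype A] [Fintype B]
    (Y : Ω → A) (Z : Ω → B) (R : ℝ) (h : condEnt p Y Z < R) (m : ℕ → ℝ)
    (hm : ∀ n : ℕ, (2:ℝ) ^ (n * R) ≤ m n) :
    ∃ s : ℝ, 0 < s ∧ s ≤ 1 ∧ Tendsto (fun n => ∑ ω, piid p n ω * (m n *
      cpr (piid p n) (fun ω i => Y (ω i)) (fun ω i => Z (ω i)) ω) ^ (-s)) atTop (nhds 0) := by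
  obtain ⟨s, hs0, hs1, hs⟩ := decay hp Y Z R (-1) (by linarith)
  refine ⟨s, hs0, hs1, ?_⟩
  rw [neg_one_mul] at hs
  set r := ∑ ω, p ω * ((2:ℝ) ^ R * cpr p Y Z ω) ^ (-s) with hr
  have hr0 : 0 ≤ r := moment_nonneg hp Y Z _ _ (by positivity)
  have hm0 : ∀ n, 0 ≤ m n := fun n => le_trans (by positivity) (hm n)
  refine squeeze_zero (fun n => moment_nonneg (piid_pmf hp n) _ _ _ _ (hm0 n)) (fun n => ?_)
    (tendsto_pow_atTop_nhds_zero_of_lt_one hr0 hs)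
  rw [hr, ← piid_moment hp]
  refine Finset.sum_le_sum fun ω _ => ?_
  rcases ((piid_pmf hp n).1 ω).eq_or_lt with h | h
  · simp [← h]
  have hc := cpr_pos (piid_pmf hp n) (fun ω i => Y (ω i)) (fun ω i => Z (ω i)) h
  refine mul_le_mul_of_nonneg_left ?_ h.le
  refine Real.rpow_le_rpow_of_nonpos (by positivity) ?_ (by linarith)
  exact mul_le_mul_of_nonneg_right (hm n) hc.le

lemma ceil_le_two_mul {x : ℝ} (hx : 0 ≤ x) : ((⌈(2:ℝ) ^ x⌉₊ : ℕ) : ℝ) ≤ 2 * (2:ℝ) ^ x := by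
  have h1 : (1:ℝ) ≤ 2 ^ x := Real.one_le_rpow (by norm_num) hx
  have := Nat.ceil_lt_add_one (show (0:ℝ) ≤ 2 ^ x by positivity)
  linarith

end Asymptotic

section Main

/-- The strategy built from a code `F` and a decoder `ψ`. -/
def mkStrat {L : ℕ} {𝒳 : Fin L → Type} {𝒴 : Fin 1 → Type} {R : ℝ} {n m : ℕ}
    (F : (Fin n → 𝒴 0) → Fin m × Fin (secCard (fun _ : Fin 1 => R) n 0))
    (ψ : (Fin n → ∀ l : {l // l ∈ (Finset.univ : Finset (Fin L))}, 𝒳 l.1) → Fin m →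
      (Fin n → 𝒴 0)) :
    Strategy 𝒳 𝒴 {Finset.univ} (fun _ : Fin 1 => R) n where
  msgCard := fun _ => m
  encM := fun d => match d with
    | ⟨0, _⟩ => fun y => (F y).1
  encS := fun d => match d with
    | ⟨0, _⟩ => fun y => (F y).2
  dec := fun _ hA x M d => match d with
    | ⟨0, _⟩ => (F (ψ (fun i l => x ⟨l.1, by
        rw [Set.mem_singleton_iff.1 hA]; exact Finset.mem_univ _⟩ i) (M 0))).2

lemma condMutInf_eq {L : ℕ} {𝒳 : Fin L → Type} {𝒴 : Fin 1 → Type}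
    [∀ l, Fintype (𝒳 l)] [∀ d, Fintype (𝒴 d)] (p : Base 𝒳 𝒴 → ℝ) (T : Finset (Fin L)) :
    condMutInf p (fun ω => ω.2 0) (XT Finset.univ) (XT T) =
      condEnt p (fun ω => ω.2 0) (XT T) - condEnt p (fun ω => ω.2 0) (XT Finset.univ) := by
  unfold condMutInf
  congr 1
  apply condEnt_congr
  · simp
  · intro ω ω'
    simp only [Prod.mk.injEq, and_iff_left_iff_imp]
    intro h
    funext l
    exact congrFun h ⟨l.1, Finset.mem_univ _⟩

lemma XTn_iff {L : ℕ} {𝒳 : Fin L → Type} {𝒴 : Fin 1 → Type} (T : Finset (Fin L)) (n : ℕ)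
    (ω ω' : Fin n → Base 𝒳 𝒴) : XTn T n ω = XTn T n ω' ↔
    (fun i => XT T (ω i)) = (fun i => XT T (ω' i)) := by
  simp only [funext_iff, XTn, XT]
  exact forall_comm

lemma converse {L : ℕ} {𝒳 : Fin L → Type} {𝒴 : Fin 1 → Type}
    [∀ l, Fintype (𝒳 l)] [∀ d, Fintype (𝒴 d)]
    (p : Base 𝒳 𝒴 → ℝ) (hp : IsPMF p) (ρ : ℝ)
    (h : Achievable p {Finset.univ} {U : Finset (Fin L) | U ≠ Finset.univ}
          (fun _ : Fin 1 => ρ)) (T : Finset (Fin L)) (hT : T ≠ Finset.univ) :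
    ρ ≤ condMutInf p (fun ω => ω.2 0) (XT Finset.univ) (XT T) := by
  obtain ⟨hρ, σ, herr, hleak, hunif⟩ := h
  have hρ0 : 0 ≤ ρ := hρ 0
  have he := herr Finset.univ rfl
  have hl := hleak T hT
  set I := condMutInf p (fun ω => ω.2 0) (XT Finset.univ) (XT T) with hI
  have key : ∀ n : ℕ, n * ρ ≤ (σ n).unif p + (σ n).leak p T + 1 +
      (σ n).err p Finset.univ rfl * (1 + n * ρ) + n * I := by
    intro n
    have hq : IsPMF (iid p n) := piid_pmf hp n
    have hc1 : (2:ℝ) ^ ((n:ℝ) * ρ) ≤ secCard (fun _ : Fin 1 => ρ) n 0 := Nat.le_ceil _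
    have hc2 : (secCard (fun _ : Fin 1 => ρ) n 0 : ℝ) ≤ 2 * (2:ℝ) ^ ((n:ℝ) * ρ) :=
      ceil_le_two_mul (by positivity)
    have hpos : (0:ℝ) < secCard (fun _ : Fin 1 => ρ) n 0 := lt_of_lt_of_le (by positivity) hc1
    have hl1 : n * ρ ≤ Real.logb 2 (secCard (fun _ : Fin 1 => ρ) n 0) := by
      rw [Real.le_logb_iff_rpow_le (by norm_num) hpos]; exact hc1
    have hl2 : Real.logb 2 (secCard (fun _ : Fin 1 => ρ) n 0) ≤ 1 + n * ρ := by
      rw [Real.logb_le_iff_le_rpow (by norm_num) hpos, Real.rpow_add (by norm_num)]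
      simpa using hc2
    have hne : Nonempty (∀ d : Fin 1, Fin (secCard (fun _ : Fin 1 => ρ) n d)) := by
      refine ⟨fun d => ⟨0, ?_⟩⟩
      have : 0 < secCard (fun _ : Fin 1 => ρ) n 0 := by exact_mod_cast hpos
      exact this
    have hcard : (Fintype.card (∀ d : Fin 1, Fin (secCard (fun _ : Fin 1 => ρ) n d)) : ℝ) =
        secCard (fun _ : Fin 1 => ρ) n 0 := by simp
    have hf := fano hq (σ n).Srv (fun ω => ((σ n).Mrv ω, XTn Finset.univ n ω))
      (fun b => (σ n).dec Finset.univ rfl b.2 b.1)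
    rw [hcard] at hf
    have hf' : condEnt (iid p n) (σ n).Srv (fun ω => ((σ n).Mrv ω, XTn Finset.univ n ω)) ≤
        1 + (σ n).err p Finset.univ rfl * Real.logb 2 (secCard (fun _ : Fin 1 => ρ) n 0) := by
      unfold Strategy.err
      convert hf using 6
      rfl
    have herr0 : 0 ≤ (σ n).err p Finset.univ rfl :=
      Finset.sum_nonneg fun ω _ => by
        split_ifs
        · exact hq.1 ω
        · exact le_rfl
    have hf2 := mul_le_mul_of_nonneg_left hl2 herr0
    have hs := converse_step hq (σ n).Srv (σ n).Mrv (fun ω i => (ω i).2)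
      (XTn T n) (XTn Finset.univ n) (fun y d => (σ n).encS d (fun i => y i d)) (fun _ => rfl)
      (fun y d => (σ n).encM d (fun i => y i d)) (fun _ => rfl)
      (fun x l => x ⟨l.1, Finset.mem_univ _⟩) (fun _ => rfl)
    have hy : ∀ ω ω' : Fin n → Base 𝒳 𝒴, (fun i => (ω i).2) = (fun i => (ω' i).2) ↔
        (fun i => (ω i).2 0) = (fun i => (ω' i).2 0) := by
      intro ω ω'
      simp [funext_iff]
    have e : ∀ U : Finset (Fin L), condEnt (iid p n) (fun ω i => (ω i).2) (XTn U n) =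
        n * condEnt p (fun ω => ω.2 0) (XT U) := by
      intro U
      rw [← piid_condEnt hp n]
      exact condEnt_congr _ _ _ _ _ hy (XTn_iff U n)
    rw [e, e, ← mul_sub, ← condMutInf_eq] at hs
    have hu : (σ n).unif p = Real.logb 2 (secCard (fun _ : Fin 1 => ρ) n 0) -
        ent (iid p n) (σ n).Srv := by simp [Strategy.unif]
    have hlk : (σ n).leak p T = _ := mutInf_eq _ _ _
    linarith
  have hlim : Tendsto (fun n : ℕ => ((σ n).unif p + (σ n).leak p T + 1 +
      (σ n).err p Finset.univ rfl * (1 + n * ρ) + n * I) / n) atTop (nhds I) := by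
    have hinv : Tendsto (fun n : ℕ => ((n:ℝ))⁻¹) atTop (nhds 0) := tendsto_inv_atTop_nhds_zero_nat
    have h1 := ((((hunif.add hl).add_const 1).add he).mul hinv).add
      ((he.mul_const ρ).add_const I)
    simp only [mul_zero, zero_mul, zero_add] at h1
    refine h1.congr' ?_
    filter_upwards [eventually_gt_atTop 0] with n hn
    have : (n:ℝ) ≠ 0 := by positivity
    field_simp
    ring
  refine ge_of_tendsto hlim ?_
  filter_upwards [eventually_gt_atTop 0] with n hn
  have : (0:ℝ) < n := by positivity
  rw [le_div_iff₀ this, mul_comm]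
  exact key n

lemma achiev {L : ℕ} (hL : 1 ≤ L) {𝒳 : Fin L → Type} {𝒴 : Fin 1 → Type}
    [∀ l, Fintype (𝒳 l)] [∀ d, Fintype (𝒴 d)] [∀ d, Nonempty (𝒴 d)]
    (p : Base 𝒳 𝒴 → ℝ) (hp : IsPMF p) (ρ : ℝ) (hρ : 0 ≤ ρ)
    (h : ∀ T : Finset (Fin L), T ≠ Finset.univ →
      ρ < condMutInf p (fun ω => ω.2 0) (XT Finset.univ) (XT T)) :
    Achievable p {Finset.univ} {U : Finset (Fin L) | U ≠ Finset.univ} (fun _ : Fin 1 => ρ) := by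
  set Y : Base 𝒳 𝒴 → 𝒴 0 := fun ω => ω.2 0 with hY
  set HL := condEnt p Y (XT Finset.univ) with hHL
  have hHL0 : 0 ≤ HL := condEnt_nonneg hp _ _
  obtain ⟨δ, hδ, hδ0⟩ : ∃ δ : ℝ, (∀ T : Finset (Fin L), T ≠ Finset.univ →
      ρ + (HL + δ) < condEnt p Y (XT T)) ∧ 0 < δ := by
    have h1 : ∀ T : Finset (Fin L), ∀ᶠ δ in nhdsWithin (0:ℝ) (Set.Ioi 0), T ≠ Finset.univ →
        ρ + (HL + δ) < condEnt p Y (XT T) := by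
      intro T
      by_cases hT : T = Finset.univ
      · exact Eventually.of_forall fun _ h => absurd hT h
      · have := h T hT
        rw [condMutInf_eq] at this
        have ht : Tendsto (fun δ : ℝ => ρ + (HL + δ)) (nhdsWithin (0:ℝ) (Set.Ioi 0))
            (nhds (ρ + (HL + 0))) :=
          ((continuous_const.add (continuous_const.add continuous_id)).tendsto
            (0:ℝ)).mono_left nhdsWithin_le_nhds
        filter_upwards [ht.eventually_lt_const (u := condEnt p Y (XT T)) (by linarith)]
          with δ hd _ using hd
    have h2 : ∀ᶠ δ in nhdsWithin (0:ℝ) (Set.Ioi 0), (0:ℝ) < δ := self_mem_nhdsWithin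
    exact ((eventually_all.2 h1).and h2).exists
  set RM := HL + δ with hRM
  have hRM0 : 0 ≤ RM := by positivity
  set m : ℕ → ℕ := fun n => ⌈(2:ℝ) ^ ((n:ℝ) * RM)⌉₊ with hm
  set k : ℕ → ℕ := fun n => secCard (fun _ : Fin 1 => ρ) n 0 with hk
  have hmpos : ∀ n, 0 < m n := fun n => Nat.ceil_pos.2 (by positivity)
  have hkpos : ∀ n, 0 < k n := fun n => Nat.ceil_pos.2 (by positivity)
  obtain ⟨s, hs0, hs1, hst⟩ := binning_tendsto hp Y (XT Finset.univ) RM (by linarith)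
    (fun n => (m n : ℝ)) (fun n => Nat.le_ceil _)
  set I : Finset (Finset (Fin L)) := Finset.univ.filter (fun T => T ≠ Finset.univ) with hI
  have hpt : ∀ T ∈ I, Tendsto (fun n => ∑ ω, piid p n ω *
      Real.logb 2 (1 + ((m n * k n : ℕ) : ℝ) *
      cpr (piid p n) (fun ω i => Y (ω i)) (fun ω i => XT T (ω i)) ω)) atTop (nhds 0) := by
    intro T hT
    have hT' : T ≠ Finset.univ := by simpa [hI] using hT
    refine privacy_tendsto hp Y (XT T) (ρ + RM) (hδ T hT') _ (fun n => by positivity) ?_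
    intro n
    have h1 : (m n : ℝ) ≤ 2 * (2:ℝ) ^ ((n:ℝ) * RM) := ceil_le_two_mul (by positivity)
    have h2 : (k n : ℝ) ≤ 2 * (2:ℝ) ^ ((n:ℝ) * ρ) := ceil_le_two_mul (by positivity)
    rw [mul_add, Real.rpow_add (by norm_num)]
    push_cast
    calc _ ≤ (2 * (2:ℝ) ^ ((n:ℝ) * RM)) * (2 * (2:ℝ) ^ ((n:ℝ) * ρ)) :=
          mul_le_mul h1 h2 (by positivity) (by positivity)
      _ = _ := by ring
  have hbound := (tendsto_finsetSum I hpt).add hst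
  simp only [Finset.sum_const_zero, add_zero] at hbound
  have hcode : ∀ n, ∃ (F : (Fin n → 𝒴 0) → Fin (m n) × Fin (k n))
      (ψ : (Fin n → ∀ l : {l // l ∈ (Finset.univ : Finset (Fin L))}, 𝒳 l.1) → Fin (m n) →
        (Fin n → 𝒴 0)),
      ∑ T ∈ I, (Real.logb 2 ((m n * k n : ℕ) : ℝ) -
        condEnt (piid p n) (fun ω => F (fun i => Y (ω i))) (fun ω i => XT T (ω i))) +
        (∑ ω : Fin n → Base 𝒳 𝒴, if ψ (fun i => XT Finset.univ (ω i))
          (F (fun i => Y (ω i))).1 ≠ (fun i => Y (ω i)) then piid p n ω else 0) ≤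
      ∑ T ∈ I, (∑ ω, piid p n ω * Real.logb 2 (1 + ((m n * k n : ℕ) : ℝ) *
      cpr (piid p n) (fun ω i => Y (ω i)) (fun ω i => XT T (ω i)) ω)) +
      ∑ ω, piid p n ω * (m n * cpr (piid p n) (fun ω i => Y (ω i))
        (fun ω i => XT Finset.univ (ω i)) ω) ^ (-s) := by
    intro n
    have : Nonempty (Fin (m n)) := ⟨⟨0, hmpos n⟩⟩
    have : Nonempty (Fin (k n)) := ⟨⟨0, hkpos n⟩⟩
    obtain ⟨F, ψ, hF⟩ := exists_code (piid_pmf hp n) (μ := Fin (m n)) (σ := Fin (k n))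
      (fun ω i => Y (ω i)) (fun ω i => XT Finset.univ (ω i))
      (fun (T : Finset (Fin L)) ω i => XT T (ω i)) I s hs0 hs1
    simp only [Fintype.card_prod, Fintype.card_fin] at hF
    refine ⟨F, ψ, ?_⟩
    convert hF
  choose F ψ hF using hcode
  -- consequences for each block length
  have hΔ0 : ∀ n, ∀ T : Finset (Fin L), 0 ≤ Real.logb 2 ((m n * k n : ℕ) : ℝ) -
        condEnt (piid p n) (fun ω => F n (fun i => Y (ω i))) (fun ω i => XT T (ω i)) := by
    intro n T
    have : Nonempty (Fin (m n) × Fin (k n)) := ⟨⟨0, hmpos n⟩, ⟨0, hkpos n⟩⟩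
    have := condEnt_le_log (piid_pmf hp n) (fun ω => F n (fun i => Y (ω i)))
      (fun ω i => XT T (ω i))
    rw [Fintype.card_prod, Fintype.card_fin, Fintype.card_fin] at this
    linarith
  have herr0 : ∀ n, 0 ≤ (∑ ω : Fin n → Base 𝒳 𝒴, if ψ n (fun i => XT Finset.univ (ω i))
          (F n (fun i => Y (ω i))).1 ≠ (fun i => Y (ω i)) then piid p n ω else 0) := by
    intro n
    refine Finset.sum_nonneg fun ω _ => ?_
    split_ifs
    · exact (piid_pmf hp n).1 ω
    · exact le_rfl
  have hmain : ∀ n, ∀ T ∈ I,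
      0 ≤ (mkStrat (F n) (ψ n)).leak p T ∧ 0 ≤ (mkStrat (F n) (ψ n)).unif p ∧
      (mkStrat (F n) (ψ n)).leak p T + (mkStrat (F n) (ψ n)).unif p ≤
      Real.logb 2 ((m n * k n : ℕ) : ℝ) -
        condEnt (piid p n) (fun ω => F n (fun i => Y (ω i))) (fun ω i => XT T (ω i)) := by
    intro n T hT
    have hq : IsPMF (iid p n) := piid_pmf hp n
    have hne1 : Nonempty (∀ d : Fin 1, Fin (secCard (fun _ : Fin 1 => ρ) n d)) :=
      ⟨fun d => ⟨0, hkpos n⟩⟩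
    have hne2 : Nonempty (Fin 1 → Fin (m n)) := ⟨fun d => ⟨0, hmpos n⟩⟩
    have hcard : (Fintype.card (∀ d : Fin 1, Fin (secCard (fun _ : Fin 1 => ρ) n d)) : ℝ) =
        k n := by simp [hk]
    have hu : (mkStrat (F n) (ψ n)).unif p = Real.logb 2 (k n) -
        ent (iid p n) (mkStrat (F n) (ψ n)).Srv := by simp [Strategy.unif, hk]
    have hu0 := ent_le_log hq (mkStrat (F n) (ψ n)).Srv
    rw [hcard] at hu0
    refine ⟨mutInf_nonneg hq _ _, by linarith, ?_⟩
    have hlk : (mkStrat (F n) (ψ n)).leak p T = _ := mutInf_eq _ _ _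
    have hM : condEnt (iid p n) (mkStrat (F n) (ψ n)).Mrv (XTn T n) ≤ Real.logb 2 (m n) := by
      refine (condEnt_le_log (A := Fin 1 → Fin (m n)) hq _ _).trans (le_of_eq ?_)
      simp
    have e1 : condEnt (piid p n) (fun ω => F n (fun i => Y (ω i))) (fun ω i => XT T (ω i)) =
        condEnt (iid p n) (fun ω => ((mkStrat (F n) (ψ n)).Srv ω, (mkStrat (F n) (ψ n)).Mrv ω))
          (XTn T n) := by
      refine condEnt_congr _ _ _ _ _ ?_ (fun ω ω' => (XTn_iff T n ω ω').symm)
      intro ω ω'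
      rw [Prod.ext_iff, Prod.mk.injEq, and_comm]
      refine and_congr ?_ ?_
      · rw [funext_iff, Fin.forall_fin_one]; rfl
      · rw [funext_iff, Fin.forall_fin_one]; rfl
    have e2 : ent (iid p n) (fun ω => (((mkStrat (F n) (ψ n)).Srv ω,
          (mkStrat (F n) (ψ n)).Mrv ω), XTn T n ω)) =
        ent (iid p n) (fun ω => ((mkStrat (F n) (ψ n)).Srv ω,
          (mkStrat (F n) (ψ n)).Mrv ω, XTn T n ω)) := by
      apply ent_congr; intro ω ω'; simp only [Prod.mk.injEq, and_assoc]
    have hlog : Real.logb 2 ((m n * k n : ℕ) : ℝ) = Real.logb 2 (m n) + Real.logb 2 (k n) := by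
      rw [Nat.cast_mul, Real.logb_mul]
      · exact_mod_cast (hmpos n).ne'
      · exact_mod_cast (hkpos n).ne'
    rw [e1, hlk, hu, hlog]
    unfold condEnt at *
    linarith
  have hle : ∀ n, ∀ T ∈ I, Real.logb 2 ((m n * k n : ℕ) : ℝ) -
        condEnt (piid p n) (fun ω => F n (fun i => Y (ω i))) (fun ω i => XT T (ω i)) ≤ _ :=
    fun n T hT => ((Finset.single_le_sum (fun T _ => hΔ0 n T) hT).trans
      (le_add_of_nonneg_right (herr0 n))).trans (hF n)
  refine ⟨fun _ => hρ, fun n => mkStrat (F n) (ψ n), ?_, ?_, ?_⟩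
  · intro A hA
    obtain rfl : A = Finset.univ := hA
    refine squeeze_zero (fun n => ?_) (fun n => ?_) hbound
    · refine Finset.sum_nonneg fun ω _ => ?_
      split_ifs
      · exact (piid_pmf hp n).1 ω
      · exact le_rfl
    · refine le_trans ?_ ((le_add_of_nonneg_left
        (Finset.sum_nonneg fun T _ => hΔ0 n T)).trans (hF n))
      refine Finset.sum_le_sum fun ω _ => ?_
      by_cases hh : ψ n (fun i => XT Finset.univ (ω i))
          (F n (fun i => Y (ω i))).1 = (fun i => Y (ω i))
      · have : (mkStrat (F n) (ψ n)).ShatRv Finset.univ (Set.mem_singleton _) ω = (mkStrat (F n) (ψ n)).Srv ω := by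
          rw [funext_iff, Fin.forall_fin_one]
          exact congrArg (fun y => (F n y).2) hh
        rw [if_neg (by simpa using this), if_neg (by simpa using hh)]
      · rw [if_pos hh]
        split_ifs
        · exact le_rfl
        · exact (piid_pmf hp n).1 ω
  · intro U hU
    have hU' : U ∈ I := by simpa [hI] using hU
    refine squeeze_zero (fun n => (hmain n U hU').1) (fun n => ?_) hbound
    have := (hmain n U hU').2
    exact le_trans (by linarith [this.1, this.2]) (hle n U hU')
  · have hU' : (∅ : Finset (Fin L)) ∈ I := by
      simp only [hI, Finset.mem_filter, Finset.mem_univ, true_and]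
      intro h0
      have : (⟨0, hL⟩ : Fin L) ∈ (∅ : Finset (Fin L)) := h0 ▸ Finset.mem_univ _
      simp at this
    refine squeeze_zero (fun n => (hmain n _ hU').2.1) (fun n => ?_) hbound
    have := (hmain n _ hU')
    exact le_trans (by linarith [this.1, this.2.2]) (hle n _ hU')

end Main

/-- **Theorem 6 (Single-dealer capacity, all-or-nothing access structure).**
`C(𝔸⋆) = min_{T ⊊ ℒ} I(Y₁ ; X_ℒ | X_T)`. -/
theorem single_dealer_all_or_nothing_capacity
    {L : ℕ} (hL : 1 ≤ L)
    {𝒳 : Fin L → Type} {𝒴 : Fin 1 → Type}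
    [∀ l, Fintype (𝒳 l)] [∀ l, Nonempty (𝒳 l)]
    [∀ d, Fintype (𝒴 d)] [∀ d, Nonempty (𝒴 d)]
    (p : Base 𝒳 𝒴 → ℝ) (hp : IsPMF p) :
    sSup {ρ : ℝ |
        Achievable p {Finset.univ} {U : Finset (Fin L) | U ≠ Finset.univ}
          (fun _ : Fin 1 => ρ)}
      = sInf {x : ℝ | ∃ T : Finset (Fin L), T ≠ Finset.univ ∧
          x = condMutInf p (fun ω => ω.2 0) (XT Finset.univ) (XT T)} := by
  set V := {x : ℝ | ∃ T : Finset (Fin L), T ≠ Finset.univ ∧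
          x = condMutInf p (fun ω => ω.2 0) (XT Finset.univ) (XT T)} with hV
  have hemp : (∅ : Finset (Fin L)) ≠ Finset.univ := by
    intro h0
    have : (⟨0, hL⟩ : Fin L) ∈ (∅ : Finset (Fin L)) := h0 ▸ Finset.mem_univ _
    simp at this
  have hne : V.Nonempty := ⟨_, ∅, hemp, rfl⟩
  have hV0 : ∀ x ∈ V, 0 ≤ x := by
    rintro x ⟨T, -, rfl⟩
    rw [condMutInf_eq, sub_nonneg]
    exact condEnt_mono hp _ _ _ (fun x l => x ⟨l.1, Finset.mem_univ _⟩) (fun _ => rfl)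
  have hbdd : BddBelow V := ⟨0, hV0⟩
  have hub : ∀ ρ ∈ {ρ : ℝ | Achievable p {Finset.univ} {U : Finset (Fin L) | U ≠ Finset.univ}
          (fun _ : Fin 1 => ρ)}, ρ ≤ sInf V := by
    intro ρ hρ
    refine le_csInf hne ?_
    rintro x ⟨T, hT, rfl⟩
    exact converse p hp ρ hρ T hT
  refine le_antisymm (Real.sSup_le hub (Real.sInf_nonneg hV0)) ?_
  refine le_of_forall_lt fun c hc => ?_
  obtain ⟨c', hc1, hc2⟩ := exists_between hc
  refine lt_of_lt_of_le hc1 ?_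
  rcases lt_or_ge c' 0 with h0 | h0
  · exact h0.le.trans (Real.sSup_nonneg fun ρ hρ => hρ.1 0)
  · refine le_csSup ⟨_, hub⟩ ?_
    exact achiev hL p hp c' h0 fun T hT => hc2.trans_le (csInf_le hbdd ⟨T, hT, rfl⟩)

end SecretSharing
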